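/- Let p > 2 and α > 0. Let u : ℝ × ℝ → ℝ be twice continuously differentiable on [0,∞) × ℝ and satisfy ∂ₜ²u + 2α·∂ₜu − ∂ₓ²u + u − |u|^(p−1)·u = 0 on [0,∞) × ℝ. Assume that for every t ≥ 0 the functions x ↦ u(t,x) and all partial derivatives of u of order at most 2 evaluated at time t are square-integrable on ℝ, that their L² norms are bounded on compact time intervals, and that for each fixed t ≥ 0 the functions u(t,x), ∂ₜu(t,x) and ∂ₓu(t,x) tend to 0 as |x| → ∞. Then the solution is bounded in the energy space: sup_{t ≥ 0} ∫_ℝ ((∂ₜu(t,x))² + (∂ₓu(t,x))² + u(t,x)²) dx < ∞. -/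

import Mathlib

open MeasureTheory Filter

/-- Time derivative `∂ₜ u`. -/
noncomputable def ut (u : ℝ × ℝ → ℝ) (t x : ℝ) : ℝ := deriv (fun s => u (s, x)) t

/-- Second time derivative `∂ₜ² u`. -/
noncomputable def utt (u : ℝ × ℝ → ℝ) (t x : ℝ) : ℝ := deriv (fun s => ut u s x) t

/-- Space derivative `∂ₓ u`. -/
noncomputable def ux (u : ℝ × ℝ → ℝ) (t x : ℝ) : ℝ := deriv (fun y => u (t, y)) x

/-- Second space derivative `∂ₓ² u`. -/
noncomputable def uxx (u : ℝ × ℝ → ℝ) (t x : ℝ) : ℝ := deriv (fun y => ux u t y) x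

/-- Mixed derivative `∂ₓ ∂ₜ u`. -/
noncomputable def utx (u : ℝ × ℝ → ℝ) (t x : ℝ) : ℝ := deriv (fun y => ut u t y) x

/-- The energy of a solution of the damped nonlinear Klein-Gordon equation. -/
noncomputable def Energy (p : ℝ) (u : ℝ × ℝ → ℝ) (t : ℝ) : ℝ :=
  (1 / 2) * ∫ x : ℝ,
    (ut u t x ^ 2 + ux u t x ^ 2 + u (t, x) ^ 2 - (2 / (p + 1)) * |u (t, x)| ^ (p + 1))

theorem le_of_hasDerivAt_nonneg {f f' : ℝ → ℝ} {a b : ℝ} (hab : a ≤ b)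
    (hf : ∀ x ∈ Set.Icc a b, HasDerivAt f (f' x) x) (hf' : ∀ x ∈ Set.Icc a b, 0 ≤ f' x) :
    f a ≤ f b := by
  refine monotoneOn_of_hasDerivWithinAt_nonneg (f' := f') (convex_Icc a b)
    (fun x hx => (hf x hx).continuousAt.continuousWithinAt)
    (fun x hx => (hf x (interior_subset hx)).hasDerivWithinAt)
    (fun x hx => hf' x (interior_subset hx)) (Set.left_mem_Icc.2 hab) (Set.right_mem_Icc.2 hab) hab

theorem le_of_hasDerivAt_nonpos {f f' : ℝ → ℝ} {a b : ℝ} (hab : a ≤ b)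
    (hf : ∀ x ∈ Set.Icc a b, HasDerivAt f (f' x) x) (hf' : ∀ x ∈ Set.Icc a b, f' x ≤ 0) :
    f b ≤ f a := by
  have := le_of_hasDerivAt_nonneg (f := fun x => -f x) (f' := fun x => -f' x) hab
    (fun x hx => (hf x hx).neg) (fun x hx => by linarith [hf' x hx])
  linarith

theorem sq_le_four_mul_of_quadratic_nonneg {a b c : ℝ} (h : ∀ l : ℝ, 0 ≤ l ^ 2 * a + l * b + c) :
    b ^ 2 ≤ 4 * a * c := by
  have := discrim_le_zero (a := a) (b := b) (c := c) (fun l => by linarith [h l])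
  unfold discrim at this
  linarith

/-- The system of ordinary differential relations satisfied by the mass `M`, its half-derivative
`P`, the kinetic term `V`, the gradient term `X` and the energy `E` of a damped Klein-Gordon
solution. -/
structure VirialSystem (p α : ℝ) (M P V X E : ℝ → ℝ) : Prop where
  hasDerivAt_mass : ∀ t > 0, HasDerivAt M (2 * P t) t
  hasDerivAt_virial : ∀ t > 0, HasDerivAt P
    ((p + 3) / 2 * V t + (p - 1) / 2 * (X t + M t) - (p + 1) * E t - 2 * α * P t) t
  hasDerivAt_energy : ∀ t > 0, HasDerivAt E (-(2 * α * V t)) t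
  quadratic_nonneg : ∀ t > 0, ∀ l : ℝ, 0 ≤ l ^ 2 * M t + l * (2 * P t) + V t
  mass_nonneg : ∀ t > 0, 0 ≤ M t
  kinetic_nonneg : ∀ t > 0, 0 ≤ V t
  gradient_nonneg : ∀ t > 0, 0 ≤ X t

namespace VirialSystem

variable {p α : ℝ} {M P V X E : ℝ → ℝ}

theorem energy_le (h : VirialSystem p α M P V X E) (hα : 0 < α) {s t : ℝ} (hs : 0 < s)
    (hst : s ≤ t) : E t ≤ E s :=
  le_of_hasDerivAt_nonpos hst (fun x hx => h.hasDerivAt_energy x (hs.trans_le hx.1))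
    (fun x hx => by nlinarith [h.kinetic_nonneg x (hs.trans_le hx.1)])

/-- Levine's concavity argument: a global solution has nonnegative energy. -/
theorem energy_nonneg (h : VirialSystem p α M P V X E) (hp : 1 < p) (hα : 0 < α) {t₀ : ℝ}
    (ht₀ : 0 < t₀) : 0 ≤ E t₀ := by
  by_contra! hneg
  obtain ⟨β, hβ⟩ : ∃ β, β = -2 * E t₀ := ⟨_, rfl⟩
  have hβ0 : 0 < β := by linarith
  have hMc : ContinuousOn M (Set.Ioi 0) := fun t ht =>
    (h.hasDerivAt_mass t ht).continuousAt.continuousWithinAt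
  obtain ⟨A, hA0, hA⟩ : ∃ A : ℝ → ℝ, A t₀ = 0 ∧ ∀ t ≥ t₀, HasDerivAt A (M t) t := by
    refine ⟨fun t => ∫ s in t₀..t, M s, by simp, fun t ht => ?_⟩
    have ht0 : 0 < t := ht₀.trans_le ht
    refine intervalIntegral.integral_hasDerivAt_right ?_ ?_ (h.hasDerivAt_mass t ht0).continuousAt
    · apply ContinuousOn.intervalIntegrable
      rw [Set.uIcc_of_le ht]
      exact hMc.mono fun s hs => ht₀.trans_le hs.1
    · exact hMc.stronglyMeasurableAtFilter isOpen_Ioi t ht0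
  obtain ⟨γ, hγ⟩ : ∃ γ, γ = (p - 1) / 4 := ⟨_, rfl⟩
  have hγ0 : 0 < γ := by rw [hγ]; linarith
  have hM0 := h.mass_nonneg t₀ ht₀
  obtain ⟨τ, hτ0, hτ⟩ : ∃ τ : ℝ, 0 < τ ∧ 2 * α * M t₀ + 1 ≤ γ * (2 * P t₀ + 2 * β * τ) := by
    refine ⟨((2 * α * M t₀ + 1) / γ + 2 * |P t₀|) / (2 * β), by positivity, ?_⟩
    have e : γ * (2 * P t₀ + 2 * β * (((2 * α * M t₀ + 1) / γ + 2 * |P t₀|) / (2 * β)))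
        = 2 * α * M t₀ + 1 + γ * (2 * (P t₀ + |P t₀|)) := by
      field_simp
      ring
    rw [e]
    have : 0 ≤ P t₀ + |P t₀| := by linarith [neg_abs_le (P t₀)]
    have := mul_nonneg hγ0.le (mul_nonneg zero_le_two this)
    linarith
  obtain ⟨T, hT⟩ : ∃ T, T = M t₀ + β * τ ^ 2 := ⟨_, rfl⟩
  have hT0 : 0 < T := by rw [hT]; positivity
  let ψ : ℝ → ℝ := fun t =>
    M t + 2 * α * A t + 2 * α * M t₀ * (T - (t - t₀)) + β * (t - t₀ + τ) ^ 2
  let ψ₁ : ℝ → ℝ := fun t => 2 * P t + 2 * α * M t - 2 * α * M t₀ + 2 * β * (t - t₀ + τ)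
  let ψ₂ : ℝ → ℝ := fun t =>
    (p + 3) * V t + (p - 1) * (X t + M t) - 2 * (p + 1) * E t + 2 * β
  let D : ℝ → ℝ := fun t => V t + (E t₀ - E t) + β
  have hpos : ∀ t ≥ t₀, 0 < t := fun t ht => ht₀.trans_le ht
  have hψ : ∀ t ≥ t₀, HasDerivAt ψ (ψ₁ t) t := by
    intro t ht
    have h1 := ((hasDerivAt_id' t).sub_const t₀)
    have := (((h.hasDerivAt_mass t (hpos t ht)).add ((hA t ht).const_mul (2 * α))).add
      ((h1.const_sub T).const_mul (2 * α * M t₀))).add (((h1.add_const τ).pow 2).const_mul β)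
    refine this.congr_deriv ?_
    simp only [ψ₁]
    push_cast
    ring
  have hψ₁ : ∀ t ≥ t₀, HasDerivAt ψ₁ (ψ₂ t) t := by
    intro t ht
    have h1 := ((hasDerivAt_id' t).sub_const t₀)
    have := ((((h.hasDerivAt_virial t (hpos t ht)).const_mul 2).add
      ((h.hasDerivAt_mass t (hpos t ht)).const_mul (2 * α))).sub_const (2 * α * M t₀)).add
      ((h1.add_const τ).const_mul (2 * β))
    refine this.congr_deriv ?_
    simp only [ψ₂]
    ring
  have hD : ∀ t ≥ t₀, β ≤ D t := fun t ht => by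
    simp only [D]
    linarith [h.kinetic_nonneg t (hpos t ht), h.energy_le hα ht₀ ht]
  have hψ₂D : ∀ t ≥ t₀, (p + 3) * D t ≤ ψ₂ t := fun t ht => by
    simp only [D, ψ₂]
    have h1 := h.energy_le hα ht₀ ht
    have h2 := h.gradient_nonneg t (hpos t ht)
    have h3 := h.mass_nonneg t (hpos t ht)
    have h4 := mul_nonneg (by linarith : 0 ≤ p - 1) (add_nonneg h2 h3)
    have h5 := mul_nonneg (by linarith : 0 ≤ p - 1) (sub_nonneg.2 h1)
    rw [hβ]
    linarith only [h4, h5]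
  have hquad : ∀ t ≥ t₀, ∀ l : ℝ,
      0 ≤ l ^ 2 * (M t + 2 * α * A t + β * (t - t₀ + τ) ^ 2) + l * ψ₁ t + D t := by
    intro t ht l
    have h1 : (fun t => l ^ 2 * (2 * α * A t) + l * (2 * α * M t) - E t) t₀ ≤
        (fun t => l ^ 2 * (2 * α * A t) + l * (2 * α * M t) - E t) t := by
      refine le_of_hasDerivAt_nonneg
        (f := fun t => l ^ 2 * (2 * α * A t) + l * (2 * α * M t) - E t)
        (f' := fun t => 2 * α * (l ^ 2 * M t + l * (2 * P t) + V t)) ht ?_ ?_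
      · intro s hs
        have := ((((hA s hs.1).const_mul (2 * α)).const_mul (l ^ 2)).add
          (((h.hasDerivAt_mass s (hpos s hs.1)).const_mul (2 * α)).const_mul l)).sub
          (h.hasDerivAt_energy s (hpos s hs.1))
        refine this.congr_deriv ?_
        ring
      · intro s hs
        have := h.quadratic_nonneg s (hpos s hs.1) l
        positivity
    have h2 := h.quadratic_nonneg t (hpos t ht) l
    have h3 : 0 ≤ β * (l * (t - t₀ + τ) + 1) ^ 2 := by positivity
    simp only [hA0] at h1
    simp only [ψ₁, D]
    linarith only [h1, h2, h3]
  have hA_nonneg : ∀ t ≥ t₀, 0 ≤ A t := fun t ht => by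
    rw [← hA0]
    exact le_of_hasDerivAt_nonneg ht (fun s hs => hA s hs.1)
      (fun s hs => h.mass_nonneg s (hpos s hs.1))
  have hψpos : ∀ t ∈ Set.Icc t₀ (t₀ + T), 0 < ψ t := by
    intro t ht
    have h1 := hA_nonneg t ht.1
    have h2 := h.mass_nonneg t (hpos t ht.1)
    have h3 : 0 ≤ T - (t - t₀) := by linarith [ht.2]
    have h4 : 0 < t - t₀ + τ := by linarith [ht.1]
    simp only [ψ]
    positivity
  have hcs : ∀ t ∈ Set.Icc t₀ (t₀ + T), ψ₁ t ^ 2 ≤ 4 * ψ t * D t := by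
    intro t ht
    refine (sq_le_four_mul_of_quadratic_nonneg (hquad t ht.1)).trans ?_
    have h3 : 0 ≤ T - (t - t₀) := by linarith [ht.2]
    have h4 : 0 ≤ 2 * α * M t₀ * (T - (t - t₀)) := by positivity
    have h5 : 0 ≤ D t := hβ0.le.trans (hD t ht.1)
    have h6 : M t + 2 * α * A t + β * (t - t₀ + τ) ^ 2 ≤ ψ t := by simp only [ψ]; linarith
    gcongr
  have hψ₁0 : 0 < ψ₁ t₀ := by
    have : 0 < γ * (2 * P t₀ + 2 * β * τ) := by
      have : 0 ≤ α * M t₀ := by positivity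
      linarith
    have := (mul_pos_iff_of_pos_left hγ0).1 this
    simp only [ψ₁]
    linarith
  have hψ₁pos : ∀ t ≥ t₀, 0 < ψ₁ t := fun t ht =>
    hψ₁0.trans_le <| le_of_hasDerivAt_nonneg ht (fun s hs => hψ₁ s hs.1) fun s hs => by
      refine le_trans ?_ (hψ₂D s hs.1)
      have := hβ0.le.trans (hD s hs.1)
      positivity
  have key : (fun t => ψ t / ψ₁ t + γ * t) (t₀ + T) ≤ (fun t => ψ t / ψ₁ t + γ * t) t₀ := by
    refine le_of_hasDerivAt_nonpos
      (f := fun t => ψ t / ψ₁ t + γ * t)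
      (f' := fun t => (ψ₁ t * ψ₁ t - ψ t * ψ₂ t) / ψ₁ t ^ 2 + γ * 1) (by linarith) ?_ ?_
    · intro t ht
      exact ((hψ t ht.1).div (hψ₁ t ht.1) (hψ₁pos t ht.1).ne').add
        ((hasDerivAt_id' t).const_mul γ)
    · intro t ht
      have h1 := hψ₁pos t ht.1
      have h2 : ψ t * ((p + 3) * D t) ≤ ψ t * ψ₂ t :=
        mul_le_mul_of_nonneg_left (hψ₂D t ht.1) (hψpos t ht).le
      have h3 := mul_le_mul_of_nonneg_left (hcs t ht) (by linarith : 0 ≤ (p + 3) / 4)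
      have h4 : (ψ₁ t * ψ₁ t - ψ t * ψ₂ t) / ψ₁ t ^ 2 ≤ -γ := by
        rw [div_le_iff₀ (by positivity), hγ]
        linarith only [h2, h3]
      linarith
  have hfin := div_pos (hψpos (t₀ + T) ⟨by linarith, le_rfl⟩) (hψ₁pos (t₀ + T) (by linarith))
  have hlt : γ * T < ψ t₀ / ψ₁ t₀ := by
    simp only at key
    linarith
  rw [lt_div_iff₀ hψ₁0] at hlt
  have e1 : ψ t₀ = M t₀ * (1 + 2 * α * T) + β * τ ^ 2 := by
    simp only [ψ, hA0]
    ring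
  have e2 : ψ₁ t₀ = 2 * P t₀ + 2 * β * τ := by
    simp only [ψ₁]
    ring
  rw [e1, e2] at hlt
  have := mul_le_mul_of_nonneg_left hτ hT0.le
  linarith only [this, hlt, hT]

theorem mass_bounded (h : VirialSystem p α M P V X E) (hp : 1 < p) (hα : 0 < α) :
    ∃ B, ∀ t ≥ 1, M t ≤ B := by
  have hpos : ∀ t : ℝ, t ≥ 1 → 0 < t := fun t ht => one_pos.trans_le ht
  have hE : ∀ t ≥ 1, 0 ≤ E t := fun t ht => h.energy_nonneg hp hα (hpos t ht)
  obtain ⟨c, hc⟩ : ∃ c, c = 2 * (p + 1) * E 1 / (p - 1) := ⟨_, rfl⟩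
  have hc' : (p - 1) * c = 2 * (p + 1) * E 1 := by
    rw [hc]; field_simp [(by linarith : p - 1 ≠ 0)]
  have hc0 : 0 ≤ c := by
    rw [hc]
    have := hE 1 le_rfl
    have : 0 < p - 1 := by linarith
    positivity
  obtain ⟨ε, hε0, hε⟩ : ∃ ε : ℝ, 0 < ε ∧ (2 * ε) ^ 2 + 2 * α * (2 * ε) = p - 1 := by
    have hs := Real.sq_sqrt (by nlinarith : 0 ≤ α ^ 2 + (p - 1))
    refine ⟨(√(α ^ 2 + (p - 1)) - α) / 2, ?_, by nlinarith⟩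
    have : α < √(α ^ 2 + (p - 1)) := Real.lt_sqrt_of_sq_lt (by linarith)
    linarith
  obtain ⟨μ, hμ⟩ : ∃ μ, μ = 2 * ε + 2 * α := ⟨_, rfl⟩
  have hμ0 : 0 < μ := by rw [hμ]; positivity
  have hprod : p - 1 = 2 * ε * μ := by rw [hμ, ← hε]; ring
  let R : ℝ → ℝ := fun t => 2 * P t + μ * (M t - c)
  let R' : ℝ → ℝ := fun t =>
    2 * ((p + 3) / 2 * V t + (p - 1) / 2 * (X t + M t) - (p + 1) * E t - 2 * α * P t)
      + μ * (2 * P t)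
  have hR : ∀ t ≥ 1, HasDerivAt R (R' t) t := fun t ht =>
    ((h.hasDerivAt_virial t (hpos t ht)).const_mul 2).add
      (((h.hasDerivAt_mass t (hpos t ht)).sub_const c).const_mul μ)
  have hRR' : ∀ t ≥ 1, 2 * ε * R t ≤ R' t := fun t ht => by
    have h1 := h.energy_le hα one_pos ht
    have h2 := mul_nonneg (by linarith : 0 ≤ p - 1) (h.gradient_nonneg t (hpos t ht))
    have h3 := mul_nonneg (by linarith : 0 ≤ p + 3) (h.kinetic_nonneg t (hpos t ht))
    have h4 := mul_le_mul_of_nonneg_left h1 (by linarith : 0 ≤ p + 1)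
    have h5 : 2 * ε * R t = 2 * ε * (2 * P t) + (p - 1) * M t - 2 * (p + 1) * E 1 := by
      rw [← hc', hprod]; simp only [R]; ring
    have h6 : R' t = (p + 3) * V t + (p - 1) * X t + (p - 1) * M t - 2 * (p + 1) * E t
        + 2 * ε * (2 * P t) := by
      simp only [R', hμ]; ring
    linarith
  have hexp : ∀ k t : ℝ, HasDerivAt (fun t => Real.exp (k * t)) (Real.exp (k * t) * k) t :=
    fun k t => by simpa using ((hasDerivAt_id' t).const_mul k).exp
  have hRle : ∀ t₀ ≥ 1, R t₀ ≤ 0 := by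
    intro t₀ ht₀
    by_contra! hRpos
    have hge : ∀ t : ℝ, t ≥ t₀ → t ≥ 1 := fun t ht => ht₀.trans ht
    obtain ⟨k, hk⟩ : ∃ k, k = Real.exp (-(2 * ε) * t₀) * R t₀ := ⟨_, rfl⟩
    have hk0 : 0 < k := by rw [hk]; positivity
    have hRk : ∀ t ≥ t₀, k ≤ Real.exp (-(2 * ε) * t) * R t := fun t ht => by
      rw [hk]
      refine le_of_hasDerivAt_nonneg (f := fun t => Real.exp (-(2 * ε) * t) * R t) ht
        (fun s hs => (hexp _ s).mul (hR s (hge s hs.1))) (fun s hs => ?_)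
      have := mul_nonneg (Real.exp_pos (-(2 * ε) * s)).le
        (sub_nonneg.2 (hRR' s (hge s hs.1)))
      linarith
    obtain ⟨k', hk'⟩ : ∃ k', k' = k / (2 * ε + μ) := ⟨_, rfl⟩
    have hk'0 : 0 < k' := by rw [hk']; positivity
    have hkk : k = k' * (2 * ε + μ) := by rw [hk']; field_simp
    obtain ⟨a, ha0, ha⟩ : ∃ a : ℝ, 0 ≤ a ∧ ∀ t ≥ t₀,
        k' * Real.exp (2 * ε * t) ≤ M t - c + a := by
      let g : ℝ → ℝ := fun t => Real.exp (μ * t) * (M t - c) - k' * Real.exp ((2 * ε + μ) * t)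
      refine ⟨|g t₀|, abs_nonneg _, fun t ht => ?_⟩
      have h1 : g t₀ ≤ g t := by
        refine le_of_hasDerivAt_nonneg ht (fun s hs => ((hexp μ s).mul
          ((h.hasDerivAt_mass s (hpos s (hge s hs.1))).sub_const c)).sub
            ((hexp (2 * ε + μ) s).const_mul k')) (fun s hs => ?_)
        have h2 := mul_le_mul_of_nonneg_left (hRk s hs.1) (Real.exp_pos ((2 * ε + μ) * s)).le
        have h3 : Real.exp ((2 * ε + μ) * s) * (Real.exp (-(2 * ε) * s) * R s)
            = Real.exp (μ * s) * R s := by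
          rw [← mul_assoc, ← Real.exp_add]; ring_nf
        rw [h3, hkk] at h2
        simp only [R] at h2
        linarith
      have h2 : k' * Real.exp (2 * ε * t) = M t - c - Real.exp (-(μ * t)) * g t := by
        have e1 : Real.exp (-(μ * t)) * Real.exp (μ * t) = 1 := by
          rw [← Real.exp_add]; simp
        have e2 : Real.exp (-(μ * t)) * Real.exp ((2 * ε + μ) * t) = Real.exp (2 * ε * t) := by
          rw [← Real.exp_add]; ring_nf
        simp only [g]
        linear_combination (-k') * e2 + (M t - c) * e1
      have h3 : Real.exp (-(μ * t)) ≤ 1 := by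
        rw [Real.exp_le_one_iff]
        have := hpos t (hge t ht)
        have : 0 < μ * t := by positivity
        linarith
      have h4 : -(Real.exp (-(μ * t)) * g t) ≤ |g t₀| := by
        have h5 : -g t ≤ |g t₀| := by linarith [neg_abs_le (g t₀)]
        calc -(Real.exp (-(μ * t)) * g t) = Real.exp (-(μ * t)) * (-g t) := by ring
          _ ≤ Real.exp (-(μ * t)) * |g t₀| := by gcongr
          _ ≤ 1 * |g t₀| := by gcongr
          _ = |g t₀| := one_mul _
      linarith
    let G : ℝ → ℝ := fun t => M t + (2 * α * ε)⁻¹ * E t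
    have hG0 : ∀ t ≥ 1, M t ≤ G t := fun t ht => by
      have := hE t ht
      have : 0 ≤ (2 * α * ε)⁻¹ * E t := by positivity
      simp only [G]
      linarith
    obtain ⟨b, hb⟩ : ∃ b, b = Real.exp (-ε * 1) * G 1 := ⟨_, rfl⟩
    have hG1 : 0 ≤ G 1 := (h.mass_nonneg 1 one_pos).trans (hG0 1 le_rfl)
    have hb0 : 0 ≤ b := by rw [hb]; positivity
    have hMb : ∀ t ≥ 1, M t ≤ b * Real.exp (ε * t) := fun t ht => by
      have h1 : Real.exp (-ε * t) * G t ≤ b := by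
        rw [hb]
        refine le_of_hasDerivAt_nonpos (f := fun t => Real.exp (-ε * t) * G t) ht
          (fun s hs => (hexp _ s).mul ((h.hasDerivAt_mass s (hpos s hs.1)).add
            ((h.hasDerivAt_energy s (hpos s hs.1)).const_mul (2 * α * ε)⁻¹))) (fun s hs => ?_)
        have h2 := h.quadratic_nonneg s (hpos s hs.1) (-ε)
        have h3 : (2 * α * ε)⁻¹ * (-(2 * α * V s)) = -(V s / ε) := by field_simp
        have h4 : 2 * P s ≤ ε * M s + V s / ε := by
          rw [← sub_nonneg]
          have : ε * M s + V s / ε - 2 * P s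
              = ((-ε) ^ 2 * M s + -ε * (2 * P s) + V s) / ε := by field_simp; ring
          rw [this]
          positivity
        rw [h3]
        have h5 : 2 * P s + -(V s / ε) - ε * G s ≤ 0 := by
          have := mul_le_mul_of_nonneg_left (hG0 s hs.1) hε0.le
          linarith
        have := mul_nonpos_of_nonneg_of_nonpos (Real.exp_pos (-ε * s)).le h5
        linarith
      have e1 : Real.exp (ε * t) * Real.exp (-ε * t) = 1 := by
        rw [← Real.exp_add]; simp
      have h2 := mul_le_mul_of_nonneg_left h1 (Real.exp_pos (ε * t)).le
      rw [← mul_assoc, e1, one_mul] at h2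
      linarith [hG0 t ht]
    let t := max t₀ ((a + b) / k' / ε)
    have ht : t₀ ≤ t := le_max_left _ _
    have h1 := ha t ht
    have h2 := hMb t (hge t ht)
    have h3 : Real.exp (2 * ε * t) = Real.exp (ε * t) * Real.exp (ε * t) := by
      rw [← Real.exp_add]; ring_nf
    have h4 : (a + b) / k' + 1 ≤ Real.exp (ε * t) := by
      refine le_trans ?_ (Real.add_one_le_exp (ε * t))
      have h5 : (a + b) / k' / ε ≤ t := le_max_right _ _
      rw [div_le_iff₀ hε0] at h5
      linarith
    have h6 : 1 ≤ Real.exp (ε * t) := by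
      have : 0 ≤ (a + b) / k' := by positivity
      linarith
    have h7 : a + b + k' ≤ k' * Real.exp (ε * t) := by
      have := mul_le_mul_of_nonneg_left h4 hk'0.le
      have e : k' * ((a + b) / k' + 1) = a + b + k' := by field_simp
      linarith
    have h8 := mul_le_mul_of_nonneg_right h7 (by linarith : 0 ≤ Real.exp (ε * t))
    have h9 := mul_le_mul_of_nonneg_left h6 ha0
    have h10 := mul_le_mul_of_nonneg_left h6 hk'0.le
    rw [h3] at h1
    linarith
  refine ⟨c + |M 1 - c|, fun t ht => ?_⟩
  have h1 : Real.exp (μ * t) * (M t - c) ≤ Real.exp (μ * 1) * (M 1 - c) := by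
    refine le_of_hasDerivAt_nonpos (f := fun t => Real.exp (μ * t) * (M t - c)) ht
      (fun s hs => (hexp μ s).mul ((h.hasDerivAt_mass s (hpos s hs.1)).sub_const c))
      (fun s hs => ?_)
    have := mul_nonpos_of_nonneg_of_nonpos (Real.exp_pos (μ * s)).le (hRle s hs.1)
    simp only [R] at this
    linarith
  have h2 : Real.exp (μ * 1) * (M 1 - c) ≤ Real.exp (μ * t) * |M 1 - c| :=
    (mul_le_mul_of_nonneg_left (le_abs_self _) (Real.exp_pos _).le).trans
      (mul_le_mul_of_nonneg_right
        (Real.exp_le_exp.2 (mul_le_mul_of_nonneg_left ht hμ0.le)) (abs_nonneg _))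
  have := le_of_mul_le_mul_left (h1.trans h2) (Real.exp_pos _)
  linarith

/-- Uniform bound for the energy norm under a Gronwall-type control of the potential term `F`. -/
theorem norm_bounded (h : VirialSystem p α M P V X E) (hp : 1 < p) (hα : 0 < α) {F F' : ℝ → ℝ}
    (hEF : ∀ t > 0, V t + X t + M t = 2 * E t + 2 / (p + 1) * F t)
    (hF : ∀ t > 0, 0 ≤ F t) (hFF' : ∀ t > 0, HasDerivAt F (F' t) t) {K : ℝ} (hK : 0 ≤ K)
    (hF' : ∀ t > 0, F' t ≤ K * ((1 + F t) * (1 + (V t + X t + M t)))) :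
    ∃ B, ∀ t ≥ 3, V t + X t + M t ≤ B := by
  obtain ⟨m, hm⟩ := h.mass_bounded hp hα
  have hpos : ∀ t : ℝ, t ≥ 1 → 0 < t := fun t ht => one_pos.trans_le ht
  have hE : ∀ t ≥ 1, 0 ≤ E t := fun t ht => h.energy_nonneg hp hα (hpos t ht)
  have hm0 : 0 ≤ m := (h.mass_nonneg 1 one_pos).trans (hm 1 le_rfl)
  obtain ⟨L, hL⟩ : ∃ L, L = 2 * (p + 1) * E 1 := ⟨_, rfl⟩
  have hL0 : 0 ≤ L := by
    rw [hL]
    have := hE 1 le_rfl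
    positivity
  let Ψ : ℝ → ℝ := fun t => 2 * P t + 2 * α * M t + L * t
  let Ψ' : ℝ → ℝ := fun t => (p + 3) * V t + (p - 1) * (X t + M t) - 2 * (p + 1) * E t + L
  have hΨ : ∀ t ≥ 1, HasDerivAt Ψ (Ψ' t) t := fun t ht => by
    have := (((h.hasDerivAt_virial t (hpos t ht)).const_mul 2).add
      ((h.hasDerivAt_mass t (hpos t ht)).const_mul (2 * α))).add
      ((hasDerivAt_id' t).const_mul L)
    refine this.congr_deriv ?_
    simp only [Ψ']
    ring
  have hN0 : ∀ t ≥ 1, 0 ≤ V t + X t + M t := fun t ht => by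
    linarith [h.kinetic_nonneg t (hpos t ht), h.gradient_nonneg t (hpos t ht),
      h.mass_nonneg t (hpos t ht)]
  have hΨN : ∀ t ≥ 1, (p - 1) * (V t + X t + M t) ≤ Ψ' t := fun t ht => by
    have h1 := mul_le_mul_of_nonneg_left (h.energy_le hα one_pos ht) (by linarith : 0 ≤ p + 1)
    have h2 := h.kinetic_nonneg t (hpos t ht)
    simp only [Ψ', hL]
    linarith
  have hΨmono : ∀ s t, 1 ≤ s → s ≤ t → Ψ s ≤ Ψ t := fun s t hs hst =>
    le_of_hasDerivAt_nonneg hst (fun r hr => hΨ r (hs.trans hr.1)) fun r hr =>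
      (mul_nonneg (by linarith) (hN0 r (hs.trans hr.1))).trans (hΨN r (hs.trans hr.1))
  have hgood : ∀ t ≥ 1, ∃ s ∈ Set.Ioo t (t + 1), |2 * P s| ≤ m := fun t ht => by
    obtain ⟨s, hs, he⟩ := exists_hasDerivAt_eq_slope M (fun t => 2 * P t)
      (by linarith : t < t + 1)
      (fun s hs => (h.hasDerivAt_mass s (hpos s (ht.trans hs.1))).continuousAt.continuousWithinAt)
      (fun s hs => h.hasDerivAt_mass s (hpos s (ht.trans hs.1.le)))
    refine ⟨s, hs, ?_⟩
    have e : 2 * P s = M (t + 1) - M t := by rw [he]; simp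
    rw [e, abs_le]
    constructor <;>
      linarith [hm t ht, hm (t + 1) (by linarith), h.mass_nonneg t (hpos t ht),
        h.mass_nonneg (t + 1) (by linarith)]
  obtain ⟨b, hb⟩ : ∃ b, b = m + 2 * α * m + L := ⟨_, rfl⟩
  have hΨb : ∀ t ≥ 2, |Ψ t - L * t| ≤ b := fun t ht => by
    obtain ⟨s, hs, hPs⟩ := hgood t (by linarith)
    obtain ⟨r, hr, hPr⟩ := hgood (t - 1) (by linarith)
    have h1 := hΨmono t s (by linarith) hs.1.le
    have h2 := hΨmono r t (by linarith [hr.1]) (by linarith [hr.2])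
    have h3 := hm s (by linarith [hs.1])
    have h5 := h.mass_nonneg r (by linarith [hr.1])
    have h6 := mul_le_mul_of_nonneg_left h3 (by linarith : 0 ≤ 2 * α)
    have h7 := mul_nonneg (by linarith : 0 ≤ 2 * α) h5
    have h8 := mul_le_mul_of_nonneg_left hs.2.le hL0
    have h9 := mul_le_mul_of_nonneg_left hr.1.le hL0
    have h10 := mul_nonneg (by linarith : 0 ≤ 2 * α) hm0
    simp only [Ψ] at h1 h2 ⊢
    rw [abs_le] at *
    constructor <;> linarith
  obtain ⟨w, hw⟩ : ∃ w, w = 2 * b + L := ⟨_, rfl⟩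
  have hosc : ∀ s t, 2 ≤ s → s ≤ t → t ≤ s + 1 → Ψ t - Ψ s ≤ w := fun s t hs hst hts => by
    have h1 := (abs_le.1 (hΨb t (by linarith))).2
    have h2 := (abs_le.1 (hΨb s hs)).1
    have h3 := mul_le_mul_of_nonneg_left hts hL0
    linarith
  have hw0 : 0 ≤ w := by
    have := hosc 2 2 le_rfl le_rfl (by norm_num)
    linarith
  have hp1 : 0 < p - 1 := by linarith
  have hp2 : 0 < p + 1 := by linarith
  obtain ⟨f, hf⟩ : ∃ f, f = (p + 1) / 2 * (w / (p - 1)) := ⟨_, rfl⟩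
  have hf0 : 0 ≤ f := by rw [hf]; positivity
  obtain ⟨q, hq⟩ : ∃ q, q = Real.log (1 + f) + K * (1 + w / (p - 1)) := ⟨_, rfl⟩
  refine ⟨2 * E 1 + 2 / (p + 1) * Real.exp q, fun t ht => ?_⟩
  have ht1 : t ≥ 1 := by linarith
  obtain ⟨s, hs, he⟩ := exists_hasDerivAt_eq_slope Ψ Ψ' (by linarith : t - 1 < t)
    (fun s hs => (hΨ s (by linarith [hs.1])).continuousAt.continuousWithinAt)
    (fun s hs => hΨ s (by linarith [hs.1]))
  have hs2 : 2 ≤ s := by linarith [hs.1]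
  have hs1 : s ≥ 1 := by linarith
  have hNs : V s + X s + M s ≤ w / (p - 1) := by
    rw [le_div_iff₀ hp1]
    have h1 := hosc (t - 1) t (by linarith) (by linarith) (by linarith)
    have h2 := hΨN s hs1
    have h3 : Ψ' s = Ψ t - Ψ (t - 1) := by rw [he]; simp
    linarith
  have hFs : F s ≤ f := by
    have h1 := hEF s (hpos s hs1)
    have h2 := hE s hs1
    have h3 : F s = (p + 1) / 2 * (2 / (p + 1) * F s) := by field_simp
    rw [h3, hf]
    gcongr
    linarith
  have hlog : Real.log (1 + F t) - K * (t + Ψ t / (p - 1))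
      ≤ Real.log (1 + F s) - K * (s + Ψ s / (p - 1)) := by
    refine le_of_hasDerivAt_nonpos
      (f := fun t => Real.log (1 + F t) - K * (t + Ψ t / (p - 1)))
      (f' := fun t => F' t / (1 + F t) - K * (1 + Ψ' t / (p - 1))) hs.2.le ?_ ?_
    · intro r hr
      have hr1 : r ≥ 1 := hs1.trans hr.1
      have := hF r (hpos r hr1)
      exact (((hFF' r (hpos r hr1)).const_add 1).log (by linarith)).sub
        (((hasDerivAt_id' r).add ((hΨ r hr1).div_const (p - 1))).const_mul K)
    · intro r hr
      have hr1 : r ≥ 1 := hs1.trans hr.1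
      have h1 := hF r (hpos r hr1)
      have h2 := hF' r (hpos r hr1)
      have h3 : F' r / (1 + F r) ≤ K * (1 + (V r + X r + M r)) := by
        rw [div_le_iff₀ (by linarith)]
        linarith
      have h4 : V r + X r + M r ≤ Ψ' r / (p - 1) := by
        rw [le_div_iff₀ hp1]
        linarith [hΨN r hr1]
      have h5 := mul_le_mul_of_nonneg_left h4 hK
      linarith
  have hFt : F t ≤ Real.exp q := by
    have h0 := hF t (hpos t ht1)
    have h0s := hF s (hpos s hs1)
    have h1 : Real.log (1 + F s) ≤ Real.log (1 + f) := Real.log_le_log (by linarith) (by linarith)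
    have h2 : (Ψ t - Ψ s) / (p - 1) ≤ w / (p - 1) := by
      gcongr
      exact hosc s t hs2 hs.2.le (by linarith [hs.1])
    have h3 : t - s ≤ 1 := by linarith [hs.1]
    have h4 : K * (t - s + (Ψ t - Ψ s) / (p - 1)) ≤ K * (1 + w / (p - 1)) := by gcongr
    have h5 : Real.log (1 + F t) ≤ q := by
      rw [hq]
      rw [sub_div] at h4
      linarith
    rw [Real.log_le_iff_le_exp (by linarith)] at h5
    linarith
  rw [hEF t (hpos t ht1)]
  have := h.energy_le hα one_pos ht1
  have := mul_le_mul_of_nonneg_left hFt (by positivity : 0 ≤ 2 / (p + 1))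
  linarith

end VirialSystem

theorem continuous_slice {g : ℝ → ℝ → ℝ}
    (hc : ContinuousOn (fun z : ℝ × ℝ => g z.1 z.2) (Set.Ioi 0 ×ˢ Set.univ)) {t : ℝ}
    (ht : 0 < t) : Continuous (g t) := by
  have h1 : Continuous (fun x : ℝ => (t, x)) := by fun_prop
  exact hc.comp_continuous h1 (fun x => ⟨ht, trivial⟩)

theorem continuousOn_slice_left {g : ℝ → ℝ → ℝ}
    (hc : ContinuousOn (fun z : ℝ × ℝ => g z.1 z.2) (Set.Ioi 0 ×ˢ Set.univ)) (x : ℝ) :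
    ContinuousOn (fun t => g t x) (Set.Ioi 0) := by
  have h1 : Continuous (fun t : ℝ => (t, x)) := by fun_prop
  exact hc.comp h1.continuousOn (fun t ht => ⟨ht, trivial⟩)

/-- `g` is continuous for positive times and dominated by a multiple of `W`, locally uniformly in
time. -/
structure DominatedBy (W g : ℝ → ℝ → ℝ) : Prop where
  continuousOn : ContinuousOn (fun z : ℝ × ℝ => g z.1 z.2) (Set.Ioi 0 ×ˢ Set.univ)
  bound : ∀ T : ℝ, ∃ C : ℝ, ∀ t, 0 < t → t ≤ T → ∀ x, |g t x| ≤ C * W t x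

namespace DominatedBy

variable {W g h : ℝ → ℝ → ℝ}

theorem add (hg : DominatedBy W g) (hh : DominatedBy W h) :
    DominatedBy W (fun t x => g t x + h t x) := by
  refine ⟨hg.continuousOn.add hh.continuousOn, fun T => ?_⟩
  obtain ⟨C, hC⟩ := hg.bound T
  obtain ⟨C', hC'⟩ := hh.bound T
  refine ⟨C + C', fun t ht htT x => (abs_add_le _ _).trans ?_⟩
  linarith [hC t ht htT x, hC' t ht htT x]

theorem const_mul (hg : DominatedBy W g) (c : ℝ) : DominatedBy W (fun t x => c * g t x) := by
  refine ⟨continuousOn_const.mul hg.continuousOn, fun T => ?_⟩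
  obtain ⟨C, hC⟩ := hg.bound T
  refine ⟨|c| * C, fun t ht htT x => ?_⟩
  rw [abs_mul, mul_assoc]
  exact mul_le_mul_of_nonneg_left (hC t ht htT x) (abs_nonneg c)

theorem integrable (hg : DominatedBy W g) (hW : ∀ t > 0, Integrable (W t)) {t : ℝ} (ht : 0 < t) :
    Integrable (g t) := by
  obtain ⟨C, hC⟩ := hg.bound t
  exact ((hW t ht).const_mul C).mono' (continuous_slice hg.continuousOn ht).aestronglyMeasurable
    (ae_of_all _ (hC t ht le_rfl))

theorem integral_abs_bounded (hg : DominatedBy W g) (hW : ∀ t > 0, Integrable (W t))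
    (hWb : ∀ T : ℝ, ∃ B, ∀ t, 0 < t → t ≤ T → ∫ x, W t x ≤ B) (hW0 : ∀ t x, 0 ≤ W t x) (T : ℝ) :
    ∃ B, 0 ≤ B ∧ ∀ t, 0 < t → t ≤ T → ∫ x, |g t x| ≤ B := by
  obtain ⟨C, hC⟩ := hg.bound T
  obtain ⟨B, hB⟩ := hWb T
  refine ⟨|C| * |B|, by positivity, fun t ht htT => ?_⟩
  calc ∫ x, |g t x| ≤ ∫ x, |C| * W t x :=
        integral_mono (hg.integrable hW ht).abs ((hW t ht).const_mul _) fun x =>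
          (hC t ht htT x).trans (mul_le_mul_of_nonneg_right (le_abs_self C) (hW0 t x))
    _ = |C| * ∫ x, W t x := integral_const_mul _ _
    _ ≤ |C| * |B| := mul_le_mul_of_nonneg_left ((hB t ht htT).trans (le_abs_self B)) (abs_nonneg C)

/-- Time increments of a spatial integral, by Fubini's theorem. -/
theorem integral_sub_integral {g' : ℝ → ℝ → ℝ} (hW : ∀ t > 0, Integrable (W t))
    (hWb : ∀ T : ℝ, ∃ B, ∀ t, 0 < t → t ≤ T → ∫ x, W t x ≤ B) (hW0 : ∀ t x, 0 ≤ W t x)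
    (hg : DominatedBy W g) (hg' : DominatedBy W g')
    (hd : ∀ t > 0, ∀ x, HasDerivAt (fun s => g s x) (g' t x) t) {s t : ℝ} (hs : 0 < s)
    (hst : s ≤ t) :
    IntervalIntegrable (fun r => ∫ x, g' r x) volume s t ∧
      (∫ x, g t x) - ∫ x, g s x = ∫ r in s..t, ∫ x, g' r x := by
  obtain ⟨B, hB0, hB⟩ := hg'.integral_abs_bounded hW hWb hW0 t
  have hsub : Set.Ioc s t ×ˢ (Set.univ : Set ℝ) ⊆ Set.Ioi 0 ×ˢ Set.univ :=
    Set.prod_mono (fun r hr => hs.trans hr.1) le_rfl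
  have hmeas : AEStronglyMeasurable (fun z : ℝ × ℝ => g' z.1 z.2)
      ((volume.restrict (Set.Ioc s t)).prod volume) := by
    have : (volume.restrict (Set.Ioc s t)).prod (volume : Measure ℝ)
        = (volume : Measure (ℝ × ℝ)).restrict (Set.Ioc s t ×ˢ Set.univ) := by
      rw [Measure.volume_eq_prod, ← Measure.prod_restrict, Measure.restrict_univ]
    rw [this]
    exact (hg'.continuousOn.mono hsub).aestronglyMeasurable
      (measurableSet_Ioc.prod MeasurableSet.univ)
  have hint : Integrable (fun z : ℝ × ℝ => g' z.1 z.2)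
      ((volume.restrict (Set.Ioc s t)).prod volume) := by
    rw [integrable_prod_iff hmeas]
    constructor
    · filter_upwards [ae_restrict_mem measurableSet_Ioc] with r hr
      exact hg'.integrable hW (hs.trans hr.1)
    · refine Integrable.of_bound (C := B) hmeas.norm.integral_prod_right' ?_
      filter_upwards [ae_restrict_mem measurableSet_Ioc] with r hr
      rw [Real.norm_of_nonneg (integral_nonneg fun x => norm_nonneg _)]
      exact hB r (hs.trans hr.1) hr.2
  constructor
  · rw [intervalIntegrable_iff_integrableOn_Ioc_of_le hst]
    exact hint.integral_prod_left
  · rw [intervalIntegral.integral_of_le hst, integral_integral_swap hint,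
      ← integral_sub (hg.integrable hW (hs.trans_le hst)) (hg.integrable hW hs)]
    congr 1
    ext x
    rw [← intervalIntegral.integral_of_le hst]
    have hIcc : Set.uIcc s t ⊆ Set.Ioi 0 := by
      rw [Set.uIcc_of_le hst]
      exact fun r hr => hs.trans_le hr.1
    exact (intervalIntegral.integral_eq_sub_of_hasDerivAt (fun r hr => hd r (hIcc hr) x)
      ((continuousOn_slice_left hg'.continuousOn x).mono hIcc).intervalIntegrable).symm

theorem continuousOn_integral {g' : ℝ → ℝ → ℝ} (hW : ∀ t > 0, Integrable (W t))
    (hWb : ∀ T : ℝ, ∃ B, ∀ t, 0 < t → t ≤ T → ∫ x, W t x ≤ B) (hW0 : ∀ t x, 0 ≤ W t x)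
    (hg : DominatedBy W g) (hg' : DominatedBy W g')
    (hd : ∀ t > 0, ∀ x, HasDerivAt (fun s => g s x) (g' t x) t) :
    ContinuousOn (fun t => ∫ x, g t x) (Set.Ioi 0) := by
  intro t ht
  have ht : 0 < t := ht
  obtain ⟨B, hB0, hB⟩ := hg'.integral_abs_bounded hW hWb hW0 (t + 1)
  have hlip : LipschitzOnWith B.toNNReal (fun t => ∫ x, g t x) (Set.Ioo 0 (t + 1)) := by
    refine LipschitzOnWith.of_dist_le_mul fun a ha b hb => ?_
    wlog hab : b ≤ a generalizing a b
    · rw [dist_comm, dist_comm a b]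
      exact this b hb a ha (le_of_not_ge hab)
    rw [Real.dist_eq, Real.dist_eq, Real.coe_toNNReal B hB0,
      (integral_sub_integral hW hWb hW0 hg hg' hd hb.1 hab).2]
    refine intervalIntegral.norm_integral_le_of_norm_le_const
      (f := fun r => ∫ x, g' r x) fun r hr => ?_
    rw [Set.uIoc_of_le hab] at hr
    exact (norm_integral_le_integral_norm (g' r)).trans
      (hB r (hb.1.trans hr.1) (hr.2.trans ha.2.le))
  exact (hlip.continuousOn.continuousAt (Ioo_mem_nhds ht (by linarith))).continuousWithinAt

theorem hasDerivAt_integral {g' : ℝ → ℝ → ℝ} (hW : ∀ t > 0, Integrable (W t))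
    (hWb : ∀ T : ℝ, ∃ B, ∀ t, 0 < t → t ≤ T → ∫ x, W t x ≤ B) (hW0 : ∀ t x, 0 ≤ W t x)
    (hg : DominatedBy W g) (hg' : DominatedBy W g')
    (hd : ∀ t > 0, ∀ x, HasDerivAt (fun s => g s x) (g' t x) t)
    (hc : ContinuousOn (fun t => ∫ x, g' t x) (Set.Ioi 0)) {t : ℝ} (ht : 0 < t) :
    HasDerivAt (fun t => ∫ x, g t x) (∫ x, g' t x) t := by
  have hs : 0 < t / 2 := by positivity
  have h1 : HasDerivAt (fun r => ∫ q in (t / 2)..r, ∫ x, g' q x) (∫ x, g' t x) t :=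
    intervalIntegral.integral_hasDerivAt_right
      (integral_sub_integral hW hWb hW0 hg hg' hd hs (by linarith)).1
      (hc.stronglyMeasurableAtFilter isOpen_Ioi t ht) (hc.continuousAt (Ioi_mem_nhds ht))
  refine (h1.add_const (∫ x, g (t / 2) x)).congr_of_eventuallyEq ?_
  filter_upwards [Ioi_mem_nhds (by linarith : t / 2 < t)] with r hr
  rw [← (integral_sub_integral hW hWb hW0 hg hg' hd hs (le_of_lt hr)).2]
  ring

end DominatedBy

theorem sq_integral_mul_le {f g : ℝ → ℝ} (hf : Integrable (fun x => f x ^ 2))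
    (hg : Integrable (fun x => g x ^ 2)) (hfg : Integrable (fun x => f x * g x)) :
    (∫ x, f x * g x) ^ 2 ≤ (∫ x, f x ^ 2) * ∫ x, g x ^ 2 := by
  have h : ∀ l : ℝ, 0 ≤ (∫ x, f x ^ 2) * (l * l) + 2 * (∫ x, f x * g x) * l + ∫ x, g x ^ 2 := by
    intro l
    have e : (∫ x, f x ^ 2) * (l * l) + 2 * (∫ x, f x * g x) * l + ∫ x, g x ^ 2
        = ∫ x, (l * f x + g x) ^ 2 := by
      have h1 : ∀ x, (l * f x + g x) ^ 2 = (l * l) * f x ^ 2 + (2 * l) * (f x * g x) + g x ^ 2 :=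
        fun x => by ring
      simp_rw [h1]
      have i1 := hf.const_mul (l * l)
      have i2 := hfg.const_mul (2 * l)
      have i3 : Integrable (fun x => l * l * f x ^ 2 + 2 * l * (f x * g x)) := i1.add i2
      rw [integral_add i3 hg, integral_add i1 i2, integral_const_mul, integral_const_mul]
      ring
    rw [e]
    exact integral_nonneg fun x => sq_nonneg _
  have := discrim_le_zero h
  unfold discrim at this
  nlinarith

theorem integrable_mul_of_sq {f g : ℝ → ℝ} (hfc : Continuous f) (hgc : Continuous g)
    (hf : Integrable (fun x => f x ^ 2)) (hg : Integrable (fun x => g x ^ 2)) :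
    Integrable (fun x => f x * g x) := by
  refine (hf.add hg).mono' (hfc.mul hgc).aestronglyMeasurable (ae_of_all _ fun x => ?_)
  rw [Real.norm_eq_abs, Pi.add_apply, abs_le]
  constructor <;> nlinarith [sq_nonneg (f x + g x), sq_nonneg (f x - g x)]

theorem abs_le_integral_abs_deriv {f f' : ℝ → ℝ} (hf : ∀ x, HasDerivAt f (f' x) x)
    (hf' : Integrable f') (hlim : Tendsto f atBot (nhds 0)) (x : ℝ) :
    |f x| ≤ ∫ y, |f' y| := by
  have h1 := integral_Iic_of_hasDerivAt_of_tendsto' (a := x) (fun y _ => hf y)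
    hf'.integrableOn hlim
  rw [sub_zero] at h1
  rw [← h1]
  exact (norm_integral_le_integral_norm f').trans
    (setIntegral_le_integral hf'.abs (ae_of_all _ fun y => abs_nonneg _))

theorem hasDerivAt_abs_rpow_mul_self {q : ℝ} (hq : 1 < q) (x : ℝ) :
    HasDerivAt (fun x : ℝ => |x| ^ q * x) ((q + 1) * |x| ^ q) x := by
  refine ((hasDerivAt_abs_rpow x hq).mul (hasDerivAt_id' x)).congr_deriv ?_
  rcases eq_or_ne x 0 with rfl | hx
  · simp [Real.zero_rpow (by linarith : q ≠ 0)]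
  · have h1 : |x| ^ (q - 2) * x ^ 2 = |x| ^ q := by
      rw [← sq_abs, ← Real.rpow_natCast, ← Real.rpow_add (abs_pos.2 hx)]
      norm_num
    linear_combination q * h1

namespace DominatedBy

variable {W f g m : ℝ → ℝ → ℝ}

theorem mul_of_sq_le (hW0 : ∀ t x, 0 ≤ W t x)
    (hf : ContinuousOn (fun z : ℝ × ℝ => f z.1 z.2) (Set.Ioi 0 ×ˢ Set.univ))
    (hg : ContinuousOn (fun z : ℝ × ℝ => g z.1 z.2) (Set.Ioi 0 ×ˢ Set.univ))
    (hfW : ∀ t x, f t x ^ 2 ≤ W t x) (hgW : ∀ t x, g t x ^ 2 ≤ W t x) :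
    DominatedBy W (fun t x => f t x * g t x) := by
  refine ⟨hf.mul hg, fun _ => ⟨1, fun t _ _ x => ?_⟩⟩
  have h1 := hfW t x
  have h2 := hgW t x
  have h3 := hW0 t x
  rw [abs_le]
  constructor <;> nlinarith [sq_nonneg (f t x + g t x), sq_nonneg (f t x - g t x)]

theorem mul_of_bounded (hW0 : ∀ t x, 0 ≤ W t x) (hg : DominatedBy W g)
    (hm : ContinuousOn (fun z : ℝ × ℝ => m z.1 z.2) (Set.Ioi 0 ×ˢ Set.univ))
    (hmb : ∀ T : ℝ, ∃ S, ∀ t, 0 < t → t ≤ T → ∀ x, |m t x| ≤ S) :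
    DominatedBy W (fun t x => m t x * g t x) := by
  refine ⟨hm.mul hg.continuousOn, fun T => ?_⟩
  obtain ⟨S, hS⟩ := hmb T
  obtain ⟨C, hC⟩ := hg.bound T
  refine ⟨|S| * |C|, fun t ht htT x => ?_⟩
  rw [abs_mul, mul_assoc]
  exact mul_le_mul ((hS t ht htT x).trans (le_abs_self S))
    ((hC t ht htT x).trans (mul_le_mul_of_nonneg_right (le_abs_self C) (hW0 t x)))
    (abs_nonneg _) (abs_nonneg _)

end DominatedBy

/-- A classical solution `w` of the damped Klein-Gordon equation for positive times together with
its derivatives `v = ∂ₜ w`, `y = ∂ₓ w`, `a = ∂ₜ² w`, `b = ∂ₓ ∂ₜ w`, `c = ∂ₓ² w`, all of them square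
integrable in space, locally uniformly in time. -/
structure KleinGordonSolution (p α : ℝ) (w v y a b c : ℝ → ℝ → ℝ) : Prop where
  hasDerivAt_w_t : ∀ t > 0, ∀ x, HasDerivAt (fun s => w s x) (v t x) t
  hasDerivAt_v_t : ∀ t > 0, ∀ x, HasDerivAt (fun s => v s x) (a t x) t
  hasDerivAt_y_t : ∀ t > 0, ∀ x, HasDerivAt (fun s => y s x) (b t x) t
  hasDerivAt_w_x : ∀ t > 0, ∀ x, HasDerivAt (w t) (y t x) x
  hasDerivAt_v_x : ∀ t > 0, ∀ x, HasDerivAt (v t) (b t x) x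
  hasDerivAt_y_x : ∀ t > 0, ∀ x, HasDerivAt (y t) (c t x) x
  cont_w : ContinuousOn (fun z : ℝ × ℝ => w z.1 z.2) (Set.Ioi 0 ×ˢ Set.univ)
  cont_v : ContinuousOn (fun z : ℝ × ℝ => v z.1 z.2) (Set.Ioi 0 ×ˢ Set.univ)
  cont_y : ContinuousOn (fun z : ℝ × ℝ => y z.1 z.2) (Set.Ioi 0 ×ˢ Set.univ)
  cont_a : ContinuousOn (fun z : ℝ × ℝ => a z.1 z.2) (Set.Ioi 0 ×ˢ Set.univ)
  cont_b : ContinuousOn (fun z : ℝ × ℝ => b z.1 z.2) (Set.Ioi 0 ×ˢ Set.univ)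
  cont_c : ContinuousOn (fun z : ℝ × ℝ => c z.1 z.2) (Set.Ioi 0 ×ˢ Set.univ)
  pde : ∀ t > 0, ∀ x, a t x + 2 * α * v t x - c t x + w t x - |w t x| ^ (p - 1) * w t x = 0
  integrable : ∀ t > 0, Integrable (fun x => w t x ^ 2 + v t x ^ 2 + y t x ^ 2 + a t x ^ 2
    + b t x ^ 2 + c t x ^ 2)
  integral_bounded : ∀ T : ℝ, ∃ B, ∀ t, 0 < t → t ≤ T →
    ∫ x, (w t x ^ 2 + v t x ^ 2 + y t x ^ 2 + a t x ^ 2 + b t x ^ 2 + c t x ^ 2) ≤ B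
  tendsto_w_atTop : ∀ t > 0, Tendsto (w t) atTop (nhds 0)
  tendsto_w_atBot : ∀ t > 0, Tendsto (w t) atBot (nhds 0)
  tendsto_v_atTop : ∀ t > 0, Tendsto (v t) atTop (nhds 0)
  tendsto_v_atBot : ∀ t > 0, Tendsto (v t) atBot (nhds 0)
  tendsto_y_atTop : ∀ t > 0, Tendsto (y t) atTop (nhds 0)
  tendsto_y_atBot : ∀ t > 0, Tendsto (y t) atBot (nhds 0)

namespace KleinGordonSolution

theorem abs_rpow_add_one_eq {p : ℝ} (hp : 2 < p) (x : ℝ) :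
    |x| ^ (p + 1) = |x| ^ (p - 1) * (x * x) := by
  rw [← abs_mul_abs_self x, ← mul_assoc, ← Real.rpow_add_one' (abs_nonneg x) (by linarith),
    ← Real.rpow_add_one' (abs_nonneg x) (by linarith)]
  ring_nf

/-- The interpolation estimate controlling the growth of the potential energy. -/
theorem integral_abs_rpow_mul_le {p : ℝ} (hp : 2 < p) {w v y : ℝ → ℝ}
    (hw : ∀ x, HasDerivAt w (y x) x) (hv : Continuous v) (hy : Continuous y)
    (hlim : Tendsto w atBot (nhds 0)) (hF : Integrable (fun x => |w x| ^ (p + 1)))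
    (hV : Integrable (fun x => v x ^ 2)) (hX : Integrable (fun x => y x ^ 2))
    (hQ : Integrable (fun x => |w x| ^ (p - 1) * (w x * v x))) :
    ∫ x, |w x| ^ (p - 1) * (w x * v x) ≤ (1 + (p + 3) / 2) *
      ((1 + ∫ x, |w x| ^ (p + 1)) * (1 + ((∫ x, v x ^ 2) + ∫ x, y x ^ 2))) := by
  have hwc : Continuous w := continuous_iff_continuousAt.2 fun x => (hw x).continuousAt
  have hf : Continuous (fun x => |w x| ^ ((p + 1) / 2)) :=
    hwc.abs.rpow_const fun _ => Or.inr (by linarith)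
  have hsq : ∀ x, (|w x| ^ ((p + 1) / 2)) ^ 2 = |w x| ^ (p + 1) := fun x => by
    rw [← Real.rpow_natCast, ← Real.rpow_mul (abs_nonneg _)]
    congr 1
    push_cast
    ring
  have hf2 : Integrable (fun x => (|w x| ^ ((p + 1) / 2)) ^ 2) := by simpa only [hsq] using hF
  have hy2 : Integrable (fun x => |y x| ^ 2) := by simpa only [sq_abs] using hX
  have hv2 : Integrable (fun x => |v x| ^ 2) := by simpa only [sq_abs] using hV
  have hfy := integrable_mul_of_sq hf hy.abs hf2 hy2
  have hfv := integrable_mul_of_sq hf hv.abs hf2 hv2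
  have hJ := sq_integral_mul_le hf2 hy2 hfy
  have hJ' := sq_integral_mul_le hf2 hv2 hfv
  simp only [hsq, sq_abs] at hJ hJ'
  have hF0 : 0 ≤ ∫ x, |w x| ^ (p + 1) := integral_nonneg fun x => by positivity
  have hV0 : 0 ≤ ∫ x, v x ^ 2 := integral_nonneg fun x => by positivity
  have hX0 : 0 ≤ ∫ x, y x ^ 2 := integral_nonneg fun x => by positivity
  have hJ0 : 0 ≤ ∫ x, |w x| ^ ((p + 1) / 2) * |y x| := integral_nonneg fun x => by positivity
  have hJ'0 : 0 ≤ ∫ x, |w x| ^ ((p + 1) / 2) * |v x| := integral_nonneg fun x => by positivity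
  have hsup : ∀ x, |w x| ^ ((p + 3) / 2)
      ≤ (p + 3) / 2 * ∫ x, |w x| ^ ((p + 1) / 2) * |y x| := by
    intro x
    have hd : ∀ x, HasDerivAt (fun x => |w x| ^ ((p + 3) / 2))
        ((p + 3) / 2 * |w x| ^ ((p + 3) / 2 - 2) * w x * y x) x := fun x =>
      (hasDerivAt_abs_rpow (w x) (by linarith : 1 < (p + 3) / 2)).comp x (hw x)
    have he : ∀ x, |(p + 3) / 2 * |w x| ^ ((p + 3) / 2 - 2) * w x * y x|
        = (p + 3) / 2 * (|w x| ^ ((p + 1) / 2) * |y x|) := fun x => by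
      have h1 : |w x| ^ ((p + 1) / 2) = |w x| ^ ((p + 3) / 2 - 2) * |w x| := by
        rw [← Real.rpow_add_one' (abs_nonneg _) (by linarith)]
        ring_nf
      rw [h1, abs_mul, abs_mul, abs_mul, abs_of_pos (by linarith : 0 < (p + 3) / 2),
        abs_of_nonneg (Real.rpow_nonneg (abs_nonneg (w x)) _)]
      ring
    have hc : Continuous (fun x => (p + 3) / 2 * |w x| ^ ((p + 3) / 2 - 2) * w x * y x) :=
      ((continuous_const.mul (hwc.abs.rpow_const fun _ => Or.inr (by linarith))).mul hwc).mul hy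
    have hi : Integrable (fun x => (p + 3) / 2 * |w x| ^ ((p + 3) / 2 - 2) * w x * y x) :=
      (hfy.const_mul ((p + 3) / 2)).mono' hc.aestronglyMeasurable
        (ae_of_all _ fun x => (he x).le)
    have hl : Tendsto (fun x => |w x| ^ ((p + 3) / 2)) atBot (nhds 0) := by
      have h1 : Continuous (fun x : ℝ => |x| ^ ((p + 3) / 2)) :=
        continuous_abs.rpow_const fun _ => Or.inr (by linarith)
      refine (h1.tendsto' 0 0 ?_).comp hlim
      rw [abs_zero, Real.zero_rpow (by linarith)]
    have := abs_le_integral_abs_deriv hd hi hl x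
    simp only [he, integral_const_mul] at this
    exact (le_abs_self _).trans this
  have hpt : ∀ x, |w x| ^ (p - 1) * (w x * v x) ≤
      (1 + (p + 3) / 2 * ∫ x, |w x| ^ ((p + 1) / 2) * |y x|)
        * (|w x| ^ ((p + 1) / 2) * |v x|) := by
    intro x
    have h1 : |w x| ^ ((p - 1) / 2) ≤ 1 + |w x| ^ ((p + 3) / 2) := by
      rcases le_total |w x| 1 with h | h
      · have := Real.rpow_le_one (abs_nonneg _) h (by linarith : 0 ≤ (p - 1) / 2)
        have := Real.rpow_nonneg (abs_nonneg (w x)) ((p + 3) / 2)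
        linarith
      · have := Real.rpow_le_rpow_of_exponent_le h (by linarith : (p - 1) / 2 ≤ (p + 3) / 2)
        linarith
    have h2 : |w x| ^ (p - 1) * |w x| = |w x| ^ ((p - 1) / 2) * |w x| ^ ((p + 1) / 2) := by
      rw [← Real.rpow_add_one' (abs_nonneg _) (by linarith),
        ← Real.rpow_add' (abs_nonneg _) (by linarith)]
      ring_nf
    calc |w x| ^ (p - 1) * (w x * v x) ≤ |w x| ^ (p - 1) * |w x * v x| := by
          gcongr
          exact le_abs_self _
      _ = |w x| ^ ((p - 1) / 2) * (|w x| ^ ((p + 1) / 2) * |v x|) := by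
          rw [abs_mul, ← mul_assoc, h2, mul_assoc]
      _ ≤ _ := by
          refine mul_le_mul_of_nonneg_right ?_ (by positivity)
          linarith [hsup x]
  have hle := integral_mono hQ (hfv.const_mul _) hpt
  rw [integral_const_mul] at hle
  refine hle.trans ?_
  generalize (∫ x, |w x| ^ ((p + 1) / 2) * |y x|) = J at *
  generalize (∫ x, |w x| ^ ((p + 1) / 2) * |v x|) = J' at *
  generalize (∫ x, |w x| ^ (p + 1)) = F at *
  generalize (∫ x, v x ^ 2) = V at *
  generalize (∫ x, y x ^ 2) = X at *
  have hFVX : 0 ≤ F * V ∧ 0 ≤ F * X ∧ 0 ≤ V * X :=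
    ⟨mul_nonneg hF0 hV0, mul_nonneg hF0 hX0, mul_nonneg hV0 hX0⟩
  have h1 : J' ≤ (1 + F) * (1 + (V + X)) := by
    refine (le_abs_self _).trans (abs_le_of_sq_le_sq (hJ'.trans ?_) (by positivity))
    nlinarith
  have h2 : J * J' ≤ (1 + F) * (1 + (V + X)) := by
    refine (le_abs_self _).trans (abs_le_of_sq_le_sq ?_ (by positivity))
    calc (J * J') ^ 2 = J ^ 2 * J' ^ 2 := by ring
      _ ≤ (F * X) * (F * V) := by gcongr
      _ ≤ (F * (V + X)) ^ 2 := by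
        have : 0 ≤ F ^ 2 * (V ^ 2 + V * X + X ^ 2) := by positivity
        linarith
      _ ≤ ((1 + F) * (1 + (V + X))) ^ 2 := pow_le_pow_left₀ (by positivity)
        (mul_le_mul (by linarith) (by linarith) (by positivity) (by positivity)) 2
  have h3 := mul_le_mul_of_nonneg_left h2 (by linarith : 0 ≤ (p + 3) / 2)
  linarith

variable {p α : ℝ} {w v y a b c : ℝ → ℝ → ℝ}

theorem integral_bounded_of_large_time (h : KleinGordonSolution p α w v y a b c) (hp : 2 < p)
    (hα : 0 < α) : ∃ B, ∀ t ≥ 3, ∫ x, (v t x ^ 2 + y t x ^ 2 + w t x ^ 2) ≤ B := by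
  let W : ℝ → ℝ → ℝ := fun t x => w t x ^ 2 + v t x ^ 2 + y t x ^ 2 + a t x ^ 2
    + b t x ^ 2 + c t x ^ 2
  have hW : ∀ t > 0, Integrable (W t) := h.integrable
  have hWb : ∀ T : ℝ, ∃ B, ∀ t, 0 < t → t ≤ T → ∫ x, W t x ≤ B := h.integral_bounded
  have hW0 : ∀ t x, 0 ≤ W t x := fun t x => by positivity
  have hwW : ∀ t x, w t x ^ 2 ≤ W t x := fun t x => by
    have : 0 ≤ v t x ^ 2 + y t x ^ 2 + a t x ^ 2 + b t x ^ 2 + c t x ^ 2 := by positivity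
    simp only [W]; linarith
  have hvW : ∀ t x, v t x ^ 2 ≤ W t x := fun t x => by
    have : 0 ≤ w t x ^ 2 + y t x ^ 2 + a t x ^ 2 + b t x ^ 2 + c t x ^ 2 := by positivity
    simp only [W]; linarith
  have hyW : ∀ t x, y t x ^ 2 ≤ W t x := fun t x => by
    have : 0 ≤ w t x ^ 2 + v t x ^ 2 + a t x ^ 2 + b t x ^ 2 + c t x ^ 2 := by positivity
    simp only [W]; linarith
  have haW : ∀ t x, a t x ^ 2 ≤ W t x := fun t x => by
    have : 0 ≤ w t x ^ 2 + v t x ^ 2 + y t x ^ 2 + b t x ^ 2 + c t x ^ 2 := by positivity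
    simp only [W]; linarith
  have hbW : ∀ t x, b t x ^ 2 ≤ W t x := fun t x => by
    have : 0 ≤ w t x ^ 2 + v t x ^ 2 + y t x ^ 2 + a t x ^ 2 + c t x ^ 2 := by positivity
    simp only [W]; linarith
  have hcW : ∀ t x, c t x ^ 2 ≤ W t x := fun t x => by
    have : 0 ≤ w t x ^ 2 + v t x ^ 2 + y t x ^ 2 + a t x ^ 2 + b t x ^ 2 := by positivity
    simp only [W]; linarith
  have dww := DominatedBy.mul_of_sq_le hW0 h.cont_w h.cont_w hwW hwW
  have dvv := DominatedBy.mul_of_sq_le hW0 h.cont_v h.cont_v hvW hvW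
  have dyy := DominatedBy.mul_of_sq_le hW0 h.cont_y h.cont_y hyW hyW
  have dwv := DominatedBy.mul_of_sq_le hW0 h.cont_w h.cont_v hwW hvW
  have dwy := DominatedBy.mul_of_sq_le hW0 h.cont_w h.cont_y hwW hyW
  have dwa := DominatedBy.mul_of_sq_le hW0 h.cont_w h.cont_a hwW haW
  have dwc := DominatedBy.mul_of_sq_le hW0 h.cont_w h.cont_c hwW hcW
  have dva := DominatedBy.mul_of_sq_le hW0 h.cont_v h.cont_a hvW haW
  have dyb := DominatedBy.mul_of_sq_le hW0 h.cont_y h.cont_b hyW hbW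
  have dvc := DominatedBy.mul_of_sq_le hW0 h.cont_v h.cont_c hvW hcW
  have hmc : ContinuousOn (fun z : ℝ × ℝ => |w z.1 z.2| ^ (p - 1)) (Set.Ioi 0 ×ˢ Set.univ) :=
    h.cont_w.abs.rpow_const fun _ _ => Or.inr (by linarith)
  have hmb : ∀ T : ℝ, ∃ S, ∀ t, 0 < t → t ≤ T → ∀ x, |(|w t x| ^ (p - 1))| ≤ S := by
    intro T
    obtain ⟨B, hB0, hB⟩ := (dwy.const_mul 2).integral_abs_bounded hW hWb hW0 T
    refine ⟨(1 + B) ^ (p - 1), fun t ht htT x => ?_⟩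
    have h1 : |w t x * w t x| ≤ ∫ x, |2 * (w t x * y t x)| := by
      refine abs_le_integral_abs_deriv (f := fun x => w t x * w t x) (fun x => ?_)
        ((dwy.const_mul 2).integrable hW ht) ?_ x
      · refine ((h.hasDerivAt_w_x t ht x).mul (h.hasDerivAt_w_x t ht x)).congr_deriv ?_
        ring
      · simpa using (h.tendsto_w_atBot t ht).mul (h.tendsto_w_atBot t ht)
    have h2 := h1.trans (hB t ht htT)
    rw [abs_mul] at h2
    rw [abs_of_nonneg (Real.rpow_nonneg (abs_nonneg _) _)]
    refine Real.rpow_le_rpow (abs_nonneg _) ?_ (by linarith)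
    nlinarith
  have dF : DominatedBy W (fun t x => |w t x| ^ (p - 1) * (w t x * w t x)) :=
    dww.mul_of_bounded hW0 hmc hmb
  have dQ : DominatedBy W (fun t x => |w t x| ^ (p - 1) * (w t x * v t x)) :=
    dwv.mul_of_bounded hW0 hmc hmb
  have dQ' := ((dvv.mul_of_bounded hW0 hmc hmb).const_mul p).add
    (dwa.mul_of_bounded hW0 hmc hmb)
  let M : ℝ → ℝ := fun t => ∫ x, w t x * w t x
  let P : ℝ → ℝ := fun t => ∫ x, w t x * v t x
  let V : ℝ → ℝ := fun t => ∫ x, v t x * v t x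
  let X : ℝ → ℝ := fun t => ∫ x, y t x * y t x
  let F : ℝ → ℝ := fun t => ∫ x, |w t x| ^ (p - 1) * (w t x * w t x)
  let Q : ℝ → ℝ := fun t => ∫ x, |w t x| ^ (p - 1) * (w t x * v t x)
  let E : ℝ → ℝ := fun t => 1 / 2 * (V t + X t + M t) + -(1 / (p + 1)) * F t
  have hdM : ∀ t > 0, ∀ x, HasDerivAt (fun s => w s x * w s x) (2 * (w t x * v t x)) t :=
    fun t ht x => ((h.hasDerivAt_w_t t ht x).mul (h.hasDerivAt_w_t t ht x)).congr_deriv (by ring)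
  have hdP : ∀ t > 0, ∀ x, HasDerivAt (fun s => w s x * v s x)
      (v t x * v t x + w t x * a t x) t :=
    fun t ht x => (h.hasDerivAt_w_t t ht x).mul (h.hasDerivAt_v_t t ht x)
  have hdV : ∀ t > 0, ∀ x, HasDerivAt (fun s => v s x * v s x) (2 * (v t x * a t x)) t :=
    fun t ht x => ((h.hasDerivAt_v_t t ht x).mul (h.hasDerivAt_v_t t ht x)).congr_deriv (by ring)
  have hdX : ∀ t > 0, ∀ x, HasDerivAt (fun s => y s x * y s x) (2 * (y t x * b t x)) t :=
    fun t ht x => ((h.hasDerivAt_y_t t ht x).mul (h.hasDerivAt_y_t t ht x)).congr_deriv (by ring)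
  have hdF : ∀ t > 0, ∀ x, HasDerivAt (fun s => |w s x| ^ (p - 1) * (w s x * w s x))
      ((p + 1) * (|w t x| ^ (p - 1) * (w t x * v t x))) t := fun t ht x => by
    simp only [← abs_rpow_add_one_eq hp]
    refine ((hasDerivAt_abs_rpow (w t x) (by linarith : 1 < p + 1)).comp t
      (h.hasDerivAt_w_t t ht x)).congr_deriv ?_
    rw [show p + 1 - 2 = p - 1 by ring]
    ring
  have hdQ : ∀ t > 0, ∀ x, HasDerivAt (fun s => |w s x| ^ (p - 1) * (w s x * v s x))
      (p * (|w t x| ^ (p - 1) * (v t x * v t x)) + |w t x| ^ (p - 1) * (w t x * a t x)) t :=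
    fun t ht x => by
      simp only [← mul_assoc]
      refine (((hasDerivAt_abs_rpow_mul_self (by linarith : 1 < p - 1) (w t x)).comp t
        (h.hasDerivAt_w_t t ht x)).mul (h.hasDerivAt_v_t t ht x)).congr_deriv ?_
      simp only [Function.comp_apply]
      ring
  have cM : ContinuousOn M (Set.Ioi 0) :=
    dww.continuousOn_integral hW hWb hW0 (dwv.const_mul 2) hdM
  have cP : ContinuousOn P (Set.Ioi 0) := dwv.continuousOn_integral hW hWb hW0 (dvv.add dwa) hdP
  have cV : ContinuousOn V (Set.Ioi 0) :=
    dvv.continuousOn_integral hW hWb hW0 (dva.const_mul 2) hdV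
  have cX : ContinuousOn X (Set.Ioi 0) :=
    dyy.continuousOn_integral hW hWb hW0 (dyb.const_mul 2) hdX
  have cF : ContinuousOn F (Set.Ioi 0) :=
    dF.continuousOn_integral hW hWb hW0 (dQ.const_mul (p + 1)) hdF
  have cQ : ContinuousOn Q (Set.Ioi 0) := dQ.continuousOn_integral hW hWb hW0 dQ' hdQ
  have hM' : ∀ t > 0, HasDerivAt M (2 * P t) t := fun t ht => by
    have e : ∀ t, ∫ x, 2 * (w t x * v t x) = 2 * P t := fun t => integral_const_mul _ _
    rw [← e]
    refine dww.hasDerivAt_integral hW hWb hW0 (dwv.const_mul 2) hdM ?_ ht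
    simp only [e]
    exact continuousOn_const.mul cP
  have hF' : ∀ t > 0, HasDerivAt F ((p + 1) * Q t) t := fun t ht => by
    have e : ∀ t, ∫ x, (p + 1) * (|w t x| ^ (p - 1) * (w t x * v t x)) = (p + 1) * Q t :=
      fun t => integral_const_mul _ _
    rw [← e]
    refine dF.hasDerivAt_integral hW hWb hW0 (dQ.const_mul (p + 1)) hdF ?_ ht
    simp only [e]
    exact continuousOn_const.mul cQ
  have hP' : ∀ t > 0, HasDerivAt P (V t - X t - M t + F t - 2 * α * P t) t := fun t ht => by
    have e : ∀ t > 0, ∫ x, (v t x * v t x + w t x * a t x)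
        = V t - X t - M t + F t - 2 * α * P t := fun t ht => by
      have i1 := dyy.integrable hW ht
      have i2 := dwc.integrable hW ht
      have i3 := dvv.integrable hW ht
      have i4 := dww.integrable hW ht
      have i5 := dF.integrable hW ht
      have i6 := (dwv.integrable hW ht).const_mul (2 * α)
      have hparts : ∫ x, (y t x * y t x + w t x * c t x) = 0 - 0 :=
        integral_of_hasDerivAt_of_tendsto (f := fun x => w t x * y t x)
          (fun x => (h.hasDerivAt_w_x t ht x).mul (h.hasDerivAt_y_x t ht x)) (i1.fun_add i2)
          (by simpa using (h.tendsto_w_atBot t ht).mul (h.tendsto_y_atBot t ht))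
          (by simpa using (h.tendsto_w_atTop t ht).mul (h.tendsto_y_atTop t ht))
      have hpt : ∀ x, v t x * v t x + w t x * a t x = (((v t x * v t x - y t x * y t x)
          - w t x * w t x) + |w t x| ^ (p - 1) * (w t x * w t x)) - 2 * α * (w t x * v t x)
          + (y t x * y t x + w t x * c t x) := fun x => by
        linear_combination (w t x) * h.pde t ht x
      simp only [hpt]
      have j1 : Integrable (fun x => v t x * v t x - y t x * y t x) := i3.sub i1
      have j2 : Integrable (fun x => v t x * v t x - y t x * y t x - w t x * w t x) := j1.sub i4
      have j3 := j2.fun_add i5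
      have j4 : Integrable (fun x => v t x * v t x - y t x * y t x - w t x * w t x
          + |w t x| ^ (p - 1) * (w t x * w t x) - 2 * α * (w t x * v t x)) := j3.sub i6
      rw [integral_add j4 (i1.fun_add i2), hparts, integral_sub j3 i6, integral_add j2 i5,
        integral_sub j1 i4, integral_sub i3 i1,
        integral_const_mul]
      simp only [V, X, M, F, P]
      ring
    rw [← e t ht]
    refine dwv.hasDerivAt_integral hW hWb hW0 (dvv.add dwa) hdP ?_ ht
    exact ((((cV.sub cX).sub cM).add cF).sub (continuousOn_const.mul cP)).congr
      fun t ht => e t ht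
  have hE' : ∀ t > 0, HasDerivAt E (-(2 * α * V t)) t := fun t ht => by
    have e : ∀ t > 0, ∫ x, ((v t x * a t x + y t x * b t x + w t x * v t x)
        + (-1) * (|w t x| ^ (p - 1) * (w t x * v t x))) = -(2 * α * V t) := fun t ht => by
      have i1 := dyb.integrable hW ht
      have i2 := dvc.integrable hW ht
      have i3 := (dvv.integrable hW ht).const_mul (-(2 * α))
      have hparts : ∫ x, (b t x * y t x + v t x * c t x) = 0 - 0 :=
        integral_of_hasDerivAt_of_tendsto (f := fun x => v t x * y t x)
          (fun x => (h.hasDerivAt_v_x t ht x).mul (h.hasDerivAt_y_x t ht x))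
          (by simpa only [mul_comm (b t _)] using i1.fun_add i2)
          (by simpa using (h.tendsto_v_atBot t ht).mul (h.tendsto_y_atBot t ht))
          (by simpa using (h.tendsto_v_atTop t ht).mul (h.tendsto_y_atTop t ht))
      have hpt : ∀ x, (v t x * a t x + y t x * b t x + w t x * v t x)
          + (-1) * (|w t x| ^ (p - 1) * (w t x * v t x))
          = -(2 * α) * (v t x * v t x) + (y t x * b t x + v t x * c t x) := fun x => by
        linear_combination (v t x) * h.pde t ht x
      simp only [mul_comm (b t _)] at hparts
      simp only [hpt]
      rw [integral_add i3 (i1.fun_add i2), hparts, integral_const_mul]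
      simp only [V]
      ring
    have eE : ∀ t > 0, ∫ x, ((1 / 2 * (v t x * v t x + y t x * y t x + w t x * w t x))
        + -(1 / (p + 1)) * (|w t x| ^ (p - 1) * (w t x * w t x))) = E t := fun t ht => by
      have i1 := dvv.integrable hW ht
      have i2 := dyy.integrable hW ht
      have i3 := dww.integrable hW ht
      have i4 := dF.integrable hW ht
      rw [integral_add (((i1.fun_add i2).fun_add i3).const_mul (1 / 2)) (i4.const_mul _),
        integral_const_mul, integral_const_mul, integral_add (i1.fun_add i2) i3, integral_add i1 i2]
    rw [← e t ht]
    have dE := (((dvv.add dyy).add dww).const_mul (1 / 2)).add (dF.const_mul (-(1 / (p + 1))))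
    have hd := dE.hasDerivAt_integral hW hWb hW0
      (((dva.add dyb).add dwv).add (dQ.const_mul (-1))) (fun t ht x => ?_) ?_ ht
    · refine hd.congr_of_eventuallyEq ?_
      filter_upwards [Ioi_mem_nhds ht] with s hs
      exact (eE s hs).symm
    · refine (((((hdV t ht x).add (hdX t ht x)).add (hdM t ht x)).const_mul (1 / 2)).add
        ((hdF t ht x).const_mul (-(1 / (p + 1))))).congr_deriv ?_
      field_simp
    · exact ((continuousOn_const.mul cV).neg).congr fun t ht => e t ht
  have hsys : VirialSystem p α M P V X E := by
    refine ⟨hM', fun t ht => (hP' t ht).congr_deriv ?_, hE', fun t ht l => ?_,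
      fun t _ => integral_nonneg fun x => mul_self_nonneg _,
      fun t _ => integral_nonneg fun x => mul_self_nonneg _,
      fun t _ => integral_nonneg fun x => mul_self_nonneg _⟩
    · simp only [E]
      field_simp
      ring
    · have i1 := (dww.integrable hW ht).const_mul (l ^ 2)
      have i2 := (dwv.integrable hW ht).const_mul (2 * l)
      have i3 := dvv.integrable hW ht
      have e : l ^ 2 * M t + l * (2 * P t) + V t = ∫ x, (l ^ 2 * (w t x * w t x)
          + 2 * l * (w t x * v t x) + v t x * v t x) := by
        rw [integral_add (i1.fun_add i2) i3, integral_add i1 i2, integral_const_mul,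
          integral_const_mul]
        ring
      rw [e]
      refine integral_nonneg fun x => ?_
      have : 0 ≤ (l * w t x + v t x) ^ 2 := sq_nonneg _
      simp only [Pi.zero_apply]
      linarith
  obtain ⟨B, hB⟩ := hsys.norm_bounded (by linarith) hα (F := F) (F' := fun t => (p + 1) * Q t)
    (K := (p + 1) * (1 + (p + 3) / 2))
    (fun t ht => by simp only [E]; field_simp; ring)
    (fun t _ => integral_nonneg fun x => mul_nonneg (by positivity) (mul_self_nonneg _)) hF'
    (by positivity)
    (fun t ht => by
      have h1 := integral_abs_rpow_mul_le hp (h.hasDerivAt_w_x t ht)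
        (continuous_slice h.cont_v ht) (continuous_slice h.cont_y ht) (h.tendsto_w_atBot t ht)
        (by simpa only [abs_rpow_add_one_eq hp] using dF.integrable hW ht)
        (by simpa only [sq] using dvv.integrable hW ht)
        (by simpa only [sq] using dyy.integrable hW ht) (dQ.integrable hW ht)
      simp only [abs_rpow_add_one_eq hp, sq] at h1
      have h2 : 0 ≤ M t := hsys.mass_nonneg t ht
      have h3 : 0 ≤ F t :=
        integral_nonneg fun x => mul_nonneg (by positivity) (mul_self_nonneg _)
      rw [mul_assoc]
      refine mul_le_mul_of_nonneg_left (h1.trans ?_) (by linarith)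
      refine mul_le_mul_of_nonneg_left ?_ (by linarith)
      refine mul_le_mul_of_nonneg_left ?_ (by linarith)
      simp only [V, X]
      linarith)
  refine ⟨B, fun t ht => ?_⟩
  have ht0 : 0 < t := by linarith
  have := hB t ht
  simp only [sq]
  rwa [integral_add ((dvv.integrable hW ht0).fun_add (dyy.integrable hW ht0))
    (dww.integrable hW ht0), integral_add (dvv.integrable hW ht0) (dyy.integrable hW ht0)]

end KleinGordonSolution

section PartialDerivatives

variable {u : ℝ × ℝ → ℝ}

theorem hasDerivAt_left_of_differentiableAt {t x : ℝ} (h : DifferentiableAt ℝ u (t, x)) :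
    HasDerivAt (fun s => u (s, x)) (fderiv ℝ u (t, x) (1, 0)) t :=
  h.hasFDerivAt.comp_hasDerivAt t ((hasDerivAt_id t).prodMk (hasDerivAt_const t x))

theorem hasDerivAt_right_of_differentiableAt {t x : ℝ} (h : DifferentiableAt ℝ u (t, x)) :
    HasDerivAt (fun z => u (t, z)) (fderiv ℝ u (t, x) (0, 1)) x :=
  h.hasFDerivAt.comp_hasDerivAt x ((hasDerivAt_const x t).prodMk (hasDerivAt_id x))

theorem kleinGordonSolution_of_contDiffOn {p α : ℝ}
    (hreg : ContDiffOn ℝ 2 u (Set.Ici (0 : ℝ) ×ˢ Set.univ))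
    (hpde : ∀ t ≥ (0 : ℝ), ∀ x : ℝ,
      utt u t x + 2 * α * ut u t x - uxx u t x + u (t, x)
        - |u (t, x)| ^ (p - 1) * u (t, x) = 0)
    (hint : ∀ t ≥ (0 : ℝ),
      Integrable (fun x : ℝ => u (t, x) ^ 2) ∧
      Integrable (fun x : ℝ => ut u t x ^ 2) ∧
      Integrable (fun x : ℝ => ux u t x ^ 2) ∧
      Integrable (fun x : ℝ => utt u t x ^ 2) ∧
      Integrable (fun x : ℝ => utx u t x ^ 2) ∧
      Integrable (fun x : ℝ => uxx u t x ^ 2))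
    (hbdd : ∀ T ≥ (0 : ℝ), ∃ B : ℝ, ∀ t : ℝ, 0 ≤ t → t ≤ T →
      (∫ x : ℝ, u (t, x) ^ 2) ≤ B ∧
      (∫ x : ℝ, ut u t x ^ 2) ≤ B ∧
      (∫ x : ℝ, ux u t x ^ 2) ≤ B ∧
      (∫ x : ℝ, utt u t x ^ 2) ≤ B ∧
      (∫ x : ℝ, utx u t x ^ 2) ≤ B ∧
      (∫ x : ℝ, uxx u t x ^ 2) ≤ B)
    (hdecay : ∀ t ≥ (0 : ℝ),
      Tendsto (fun x : ℝ => u (t, x)) atTop (nhds 0) ∧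
      Tendsto (fun x : ℝ => u (t, x)) atBot (nhds 0) ∧
      Tendsto (fun x : ℝ => ut u t x) atTop (nhds 0) ∧
      Tendsto (fun x : ℝ => ut u t x) atBot (nhds 0) ∧
      Tendsto (fun x : ℝ => ux u t x) atTop (nhds 0) ∧
      Tendsto (fun x : ℝ => ux u t x) atBot (nhds 0)) :
    KleinGordonSolution p α (fun t x => u (t, x)) (ut u) (ux u) (utt u) (utx u) (uxx u) := by
  have hU : IsOpen (Set.Ioi (0 : ℝ) ×ˢ (Set.univ : Set ℝ)) := isOpen_Ioi.prod isOpen_univ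
  have hsub : Set.Ioi (0 : ℝ) ×ˢ (Set.univ : Set ℝ) ⊆ Set.Ici 0 ×ˢ Set.univ :=
    Set.prod_mono Set.Ioi_subset_Ici_self le_rfl
  have hu : ContDiffOn ℝ 2 u (Set.Ioi (0 : ℝ) ×ˢ Set.univ) := hreg.mono hsub
  have hmem : ∀ t > (0 : ℝ), ∀ x : ℝ,
      Set.Ioi (0 : ℝ) ×ˢ (Set.univ : Set ℝ) ∈ nhds (t, x) :=
    fun t ht x => hU.mem_nhds ⟨ht, trivial⟩
  have hu' : ContDiffOn ℝ 1 (fderiv ℝ u) (Set.Ioi (0 : ℝ) ×ˢ Set.univ) :=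
    hu.fderiv_of_isOpen hU (by norm_num)
  have hue : ∀ e : ℝ × ℝ, ContDiffOn ℝ 1 (fun z => fderiv ℝ u z e) (Set.Ioi (0 : ℝ) ×ˢ Set.univ) :=
    fun e => hu'.clm_apply contDiffOn_const
  have hud : ∀ t > (0 : ℝ), ∀ x : ℝ, DifferentiableAt ℝ u (t, x) := fun t ht x =>
    (hu.contDiffAt (hmem t ht x)).differentiableAt (by norm_num)
  have hued : ∀ e : ℝ × ℝ, ∀ t > (0 : ℝ), ∀ x : ℝ,
      DifferentiableAt ℝ (fun z => fderiv ℝ u z e) (t, x) := fun e t ht x =>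
    ((hue e).contDiffAt (hmem t ht x)).differentiableAt (by norm_num)
  have huec : ∀ e d : ℝ × ℝ, ContinuousOn (fun z => fderiv ℝ (fun z => fderiv ℝ u z e) z d)
      (Set.Ioi (0 : ℝ) ×ˢ Set.univ) := fun e d =>
    ((hue e).continuousOn_fderiv_of_isOpen hU le_rfl).clm_apply continuousOn_const
  have hsymm : ∀ t > (0 : ℝ), ∀ x : ℝ, fderiv ℝ (fun z => fderiv ℝ u z (0, 1)) (t, x) (1, 0)
      = fderiv ℝ (fun z => fderiv ℝ u z (1, 0)) (t, x) (0, 1) := fun t ht x => by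
    have h1 : DifferentiableAt ℝ (fderiv ℝ u) (t, x) :=
      (hu'.contDiffAt (hmem t ht x)).differentiableAt (by norm_num)
    have h2 := (hu.contDiffAt (hmem t ht x)).isSymmSndFDerivAt (by simp)
    rw [fderiv_clm_apply h1 (differentiableAt_const _),
      fderiv_clm_apply h1 (differentiableAt_const _)]
    simpa using h2 (1, 0) (0, 1)
  have et : ∀ t > (0 : ℝ), ∀ x, ut u t x = fderiv ℝ u (t, x) (1, 0) := fun t ht x =>
    (hasDerivAt_left_of_differentiableAt (hud t ht x)).deriv
  have ex : ∀ t > (0 : ℝ), ∀ x, ux u t x = fderiv ℝ u (t, x) (0, 1) := fun t ht x =>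
    (hasDerivAt_right_of_differentiableAt (hud t ht x)).deriv
  have dtt : ∀ t > (0 : ℝ), ∀ x, HasDerivAt (fun s => ut u s x)
      (fderiv ℝ (fun z => fderiv ℝ u z (1, 0)) (t, x) (1, 0)) t := fun t ht x => by
    refine (hasDerivAt_left_of_differentiableAt (hued (1, 0) t ht x)).congr_of_eventuallyEq ?_
    filter_upwards [Ioi_mem_nhds ht] with s hs using et s hs x
  have dxt : ∀ t > (0 : ℝ), ∀ x, HasDerivAt (fun s => ux u s x)
      (fderiv ℝ (fun z => fderiv ℝ u z (0, 1)) (t, x) (1, 0)) t := fun t ht x => by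
    refine (hasDerivAt_left_of_differentiableAt (hued (0, 1) t ht x)).congr_of_eventuallyEq ?_
    filter_upwards [Ioi_mem_nhds ht] with s hs using ex s hs x
  have dtx : ∀ t > (0 : ℝ), ∀ x, HasDerivAt (ut u t)
      (fderiv ℝ (fun z => fderiv ℝ u z (1, 0)) (t, x) (0, 1)) x := fun t ht x =>
    (hasDerivAt_right_of_differentiableAt (hued (1, 0) t ht x)).congr_of_eventuallyEq
      (Eventually.of_forall (et t ht))
  have dxx : ∀ t > (0 : ℝ), ∀ x, HasDerivAt (ux u t)
      (fderiv ℝ (fun z => fderiv ℝ u z (0, 1)) (t, x) (0, 1)) x := fun t ht x =>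
    (hasDerivAt_right_of_differentiableAt (hued (0, 1) t ht x)).congr_of_eventuallyEq
      (Eventually.of_forall (ex t ht))
  have ett : ∀ t > (0 : ℝ), ∀ x,
      utt u t x = fderiv ℝ (fun z => fderiv ℝ u z (1, 0)) (t, x) (1, 0) :=
    fun t ht x => (dtt t ht x).deriv
  have etx : ∀ t > (0 : ℝ), ∀ x,
      utx u t x = fderiv ℝ (fun z => fderiv ℝ u z (1, 0)) (t, x) (0, 1) :=
    fun t ht x => (dtx t ht x).deriv
  have exx : ∀ t > (0 : ℝ), ∀ x,
      uxx u t x = fderiv ℝ (fun z => fderiv ℝ u z (0, 1)) (t, x) (0, 1) :=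
    fun t ht x => (dxx t ht x).deriv
  exact
  { hasDerivAt_w_t := fun t ht x => by
      rw [et t ht x]
      exact hasDerivAt_left_of_differentiableAt (hud t ht x)
    hasDerivAt_v_t := fun t ht x => (dtt t ht x).congr_deriv (ett t ht x).symm
    hasDerivAt_y_t := fun t ht x =>
      (dxt t ht x).congr_deriv ((hsymm t ht x).trans (etx t ht x).symm)
    hasDerivAt_w_x := fun t ht x => by
      rw [ex t ht x]
      exact hasDerivAt_right_of_differentiableAt (hud t ht x)
    hasDerivAt_v_x := fun t ht x => (dtx t ht x).congr_deriv (etx t ht x).symm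
    hasDerivAt_y_x := fun t ht x => (dxx t ht x).congr_deriv (exx t ht x).symm
    cont_w := hu.continuousOn
    cont_v := (hue (1, 0)).continuousOn.congr fun z hz => et z.1 hz.1 z.2
    cont_y := (hue (0, 1)).continuousOn.congr fun z hz => ex z.1 hz.1 z.2
    cont_a := (huec (1, 0) (1, 0)).congr fun z hz => ett z.1 hz.1 z.2
    cont_b := (huec (1, 0) (0, 1)).congr fun z hz => etx z.1 hz.1 z.2
    cont_c := (huec (0, 1) (0, 1)).congr fun z hz => exx z.1 hz.1 z.2
    pde := fun t ht x => hpde t ht.le x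
    integrable := fun t ht => by
      obtain ⟨h1, h2, h3, h4, h5, h6⟩ := hint t ht.le
      exact ((((h1.add h2).add h3).add h4).add h5).add h6
    integral_bounded := fun T => by
      obtain ⟨B, hB⟩ := hbdd (max T 0) (le_max_right _ _)
      refine ⟨6 * B, fun t ht htT => ?_⟩
      obtain ⟨h1, h2, h3, h4, h5, h6⟩ := hint t ht.le
      obtain ⟨b1, b2, b3, b4, b5, b6⟩ := hB t ht.le (htT.trans (le_max_left _ _))
      have i2 := h1.fun_add h2
      have i3 := i2.fun_add h3
      have i4 := i3.fun_add h4
      have i5 := i4.fun_add h5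
      rw [integral_add i5 h6, integral_add i4 h5, integral_add i3 h4, integral_add i2 h3,
        integral_add h1 h2]
      linarith
    tendsto_w_atTop := fun t ht => (hdecay t ht.le).1
    tendsto_w_atBot := fun t ht => (hdecay t ht.le).2.1
    tendsto_v_atTop := fun t ht => (hdecay t ht.le).2.2.1
    tendsto_v_atBot := fun t ht => (hdecay t ht.le).2.2.2.1
    tendsto_y_atTop := fun t ht => (hdecay t ht.le).2.2.2.2.1
    tendsto_y_atBot := fun t ht => (hdecay t ht.le).2.2.2.2.2 }

end PartialDerivatives

theorem global_solution_bounded (p α : ℝ) (hp : 2 < p) (hα : 0 < α)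
    (u : ℝ × ℝ → ℝ)
    (hreg : ContDiffOn ℝ 2 u (Set.Ici (0 : ℝ) ×ˢ Set.univ))
    (hpde : ∀ t ≥ (0 : ℝ), ∀ x : ℝ,
      utt u t x + 2 * α * ut u t x - uxx u t x + u (t, x)
        - |u (t, x)| ^ (p - 1) * u (t, x) = 0)
    (hint : ∀ t ≥ (0 : ℝ),
      Integrable (fun x : ℝ => u (t, x) ^ 2) ∧
      Integrable (fun x : ℝ => ut u t x ^ 2) ∧
      Integrable (fun x : ℝ => ux u t x ^ 2) ∧
      Integrable (fun x : ℝ => utt u t x ^ 2) ∧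
      Integrable (fun x : ℝ => utx u t x ^ 2) ∧
      Integrable (fun x : ℝ => uxx u t x ^ 2))
    (hbdd : ∀ T ≥ (0 : ℝ), ∃ B : ℝ, ∀ t : ℝ, 0 ≤ t → t ≤ T →
      (∫ x : ℝ, u (t, x) ^ 2) ≤ B ∧
      (∫ x : ℝ, ut u t x ^ 2) ≤ B ∧
      (∫ x : ℝ, ux u t x ^ 2) ≤ B ∧
      (∫ x : ℝ, utt u t x ^ 2) ≤ B ∧
      (∫ x : ℝ, utx u t x ^ 2) ≤ B ∧
      (∫ x : ℝ, uxx u t x ^ 2) ≤ B)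
    (hdecay : ∀ t ≥ (0 : ℝ),
      Tendsto (fun x : ℝ => u (t, x)) atTop (nhds 0) ∧
      Tendsto (fun x : ℝ => u (t, x)) atBot (nhds 0) ∧
      Tendsto (fun x : ℝ => ut u t x) atTop (nhds 0) ∧
      Tendsto (fun x : ℝ => ut u t x) atBot (nhds 0) ∧
      Tendsto (fun x : ℝ => ux u t x) atTop (nhds 0) ∧
      Tendsto (fun x : ℝ => ux u t x) atBot (nhds 0)) :
    ∃ B : ℝ, ∀ t ≥ (0 : ℝ),
      (∫ x : ℝ, (ut u t x ^ 2 + ux u t x ^ 2 + u (t, x) ^ 2)) ≤ B := by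
  obtain ⟨B, hB⟩ := (kleinGordonSolution_of_contDiffOn hreg hpde hint hbdd
    hdecay).integral_bounded_of_large_time hp hα
  obtain ⟨B', hB'⟩ := hbdd 3 (by norm_num)
  refine ⟨max B (3 * B'), fun t ht => ?_⟩
  rcases le_total 3 t with h3 | h3
  · exact (hB t h3).trans (le_max_left _ _)
  · refine le_trans ?_ (le_max_right _ _)
    obtain ⟨i1, i2, i3, -⟩ := hint t ht
    obtain ⟨b1, b2, b3, -⟩ := hB' t ht h3
    rw [integral_add (i2.fun_add i3) i1, integral_add i2 i3]
    linarith
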